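/- Let C be a skeletally small triangulated category (satisfying the octahedral axiom) with shift functor T, fix objects X, Y, Z, M of C, and fix a set R of representatives of the isomorphism classes of objects of C. Then there is a bijection between the disjoint union, over L ∈ R, of the orbit sets (W_{XY}^L × W_{LZ}^M)/Aut(X,Y,Z,L) and the disjoint union, over L' ∈ R, of the orbit sets (W_{XL'}^M × W_{YZ}^{L'})/Aut(X,Y,Z,L'). -/

import Mathlib

open CategoryTheory CategoryTheory.Limits CategoryTheory.Pretriangulated

universe v u

namespace HallTri

variable {C : Type u} [Category.{v} C] [HasZeroObject C] [HasShift C ℤ] [Preadditive C]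
  [∀ n : ℤ, (shiftFunctor C n).Additive] [Pretriangulated C] [IsTriangulated C]

/-- `WT X Y L` : the set of distinguished triangles `Y → L → X → TY`. -/
def WT (X Y L : C) : Type v :=
  {t : (Y ⟶ L) × (L ⟶ X) × (X ⟶ Y⟦(1 : ℤ)⟧) //
    Triangle.mk t.1 t.2.1 t.2.2 ∈ distTriang C}

/-- The orbit relation on `W_{XY}^L × W_{LZ}^M` for the action of
`Aut(X,Y,Z,L) = Aut X × Aut Y × Aut Z × Aut L`, where `(ξ,η,ζ,λ)` sends
`((f,g,h),(l,m,n))` to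
`((λ∘f∘η⁻¹, ξ∘g∘λ⁻¹, (Tη)∘h∘ξ⁻¹), (l∘ζ⁻¹, λ∘m, (Tζ)∘n∘λ⁻¹))`. -/
def PairRelT (X Y Z L M : C) (p q : WT X Y L × WT L Z M) : Prop :=
  ∃ (ξ : Aut X) (η : Aut Y) (ζ : Aut Z) (l : Aut L),
    q.1.1.1 = η.inv ≫ p.1.1.1 ≫ l.hom ∧
    q.1.1.2.1 = l.inv ≫ p.1.1.2.1 ≫ ξ.hom ∧
    q.1.1.2.2 = ξ.inv ≫ p.1.1.2.2 ≫ (shiftFunctor C (1 : ℤ)).map η.hom ∧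
    q.2.1.1 = ζ.inv ≫ p.2.1.1 ∧
    q.2.1.2.1 = p.2.1.2.1 ≫ l.hom ∧
    q.2.1.2.2 = l.inv ≫ p.2.1.2.2 ≫ (shiftFunctor C (1 : ℤ)).map ζ.hom

/-- The orbit relation on `W_{XL'}^M × W_{YZ}^{L'}` for the dual action of
`Aut(X,Y,Z,L')`, where `(ξ,η,ζ,λ')` sends `((f',g',h'),(l',m',n'))` to
`((f'∘λ'⁻¹, ξ∘g', (Tλ')∘h'∘ξ⁻¹), (λ'∘l'∘ζ⁻¹, η∘m'∘λ'⁻¹, (Tζ)∘n'∘η⁻¹))`. -/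
def PairRelT' (X Y Z L' M : C) (p q : WT X L' M × WT Y Z L') : Prop :=
  ∃ (ξ : Aut X) (η : Aut Y) (ζ : Aut Z) (l : Aut L'),
    q.1.1.1 = l.inv ≫ p.1.1.1 ∧
    q.1.1.2.1 = p.1.1.2.1 ≫ ξ.hom ∧
    q.1.1.2.2 = ξ.inv ≫ p.1.1.2.2 ≫ (shiftFunctor C (1 : ℤ)).map l.hom ∧
    q.2.1.1 = ζ.inv ≫ p.2.1.1 ≫ l.hom ∧
    q.2.1.2.1 = l.inv ≫ p.2.1.2.1 ≫ η.hom ∧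
    q.2.1.2.2 = η.inv ≫ p.2.1.2.2 ≫ (shiftFunctor C (1 : ℤ)).map ζ.hom

section Aux

set_option linter.unusedSectionVars false

lemma rot_iff {A B D : C} (f : A ⟶ B) (g : B ⟶ D) (h : D ⟶ A⟦(1 : ℤ)⟧) :
    Triangle.mk f g h ∈ distTriang C ↔
      Triangle.mk g h (-(shiftFunctor C (1 : ℤ)).map f) ∈ distTriang C :=
  rotate_distinguished_triangle _

lemma third_iso {A B D A₁ B₁ D₁ : C} {f : A ⟶ B} {g : B ⟶ D} {h : D ⟶ A⟦(1 : ℤ)⟧}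
    {f₁ : A₁ ⟶ B₁} {g₁ : B₁ ⟶ D₁} {h₁ : D₁ ⟶ A₁⟦(1 : ℤ)⟧}
    (H : Triangle.mk f g h ∈ distTriang C) (H₁ : Triangle.mk f₁ g₁ h₁ ∈ distTriang C)
    (a : A ≅ A₁) (b : B ≅ B₁) (comm : f ≫ b.hom = a.hom ≫ f₁) :
    ∃ c : D ≅ D₁, g ≫ c.hom = b.hom ≫ g₁ ∧
      h ≫ (shiftFunctor C (1 : ℤ)).map a.hom = c.hom ≫ h₁ := by
  obtain ⟨(c : D ⟶ D₁), h2, h3⟩ := complete_distinguished_triangle_morphism _ _ H H₁ a.hom b.hom comm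
  have : IsIso c := isIso₃_of_isIso₁₂
    (Triangle.homMk (Triangle.mk f g h) (Triangle.mk f₁ g₁ h₁) a.hom b.hom c comm h2 h3) H H₁
    (inferInstanceAs (IsIso a.hom)) (inferInstanceAs (IsIso b.hom))
  exact ⟨asIso c, h2, h3⟩

lemma first_iso {A B D A₁ B₁ D₁ : C} {f : A ⟶ B} {g : B ⟶ D} {h : D ⟶ A⟦(1 : ℤ)⟧}
    {f₁ : A₁ ⟶ B₁} {g₁ : B₁ ⟶ D₁} {h₁ : D₁ ⟶ A₁⟦(1 : ℤ)⟧}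
    (H : Triangle.mk f g h ∈ distTriang C) (H₁ : Triangle.mk f₁ g₁ h₁ ∈ distTriang C)
    (b : B ≅ B₁) (c : D ≅ D₁) (comm : g ≫ c.hom = b.hom ≫ g₁) :
    ∃ a : A ≅ A₁, f ≫ b.hom = a.hom ≫ f₁ ∧
      h ≫ (shiftFunctor C (1 : ℤ)).map a.hom = c.hom ≫ h₁ := by
  obtain ⟨(a : A ⟶ A₁), h2, h3⟩ := complete_distinguished_triangle_morphism₁ _ _ H H₁ b.hom c.hom comm
  have : IsIso a := isIso₁_of_isIso₂₃
    (Triangle.homMk (Triangle.mk f g h) (Triangle.mk f₁ g₁ h₁) a b.hom c.hom h2 comm h3) H H₁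
    (inferInstanceAs (IsIso b.hom)) (inferInstanceAs (IsIso c.hom))
  exact ⟨asIso a, h2, h3⟩

lemma dist_of_iso {A B D A₁ B₁ D₁ : C} {f : A ⟶ B} {g : B ⟶ D} {h : D ⟶ A⟦(1 : ℤ)⟧}
    {f₁ : A₁ ⟶ B₁} {g₁ : B₁ ⟶ D₁} {h₁ : D₁ ⟶ A₁⟦(1 : ℤ)⟧}
    (H : Triangle.mk f g h ∈ distTriang C) (a : A ≅ A₁) (b : B ≅ B₁) (c : D ≅ D₁)
    (c1 : f ≫ b.hom = a.hom ≫ f₁) (c2 : g ≫ c.hom = b.hom ≫ g₁)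
    (c3 : h ≫ (shiftFunctor C (1 : ℤ)).map a.hom = c.hom ≫ h₁) :
    Triangle.mk f₁ g₁ h₁ ∈ distTriang C :=
  isomorphic_distinguished _ H _ (Iso.symm (Triangle.isoMk (Triangle.mk f g h)
    (Triangle.mk f₁ g₁ h₁) a b c c1 c2 c3))

lemma inr_fst_dist (M Y : C) :
    Triangle.mk (biprod.inr : Y ⟶ M ⊞ Y) biprod.fst 0 ∈ distTriang C := by
  have H : Triangle.mk (biprod.inl : Y ⟶ Y ⊞ M) biprod.snd 0 ∈ distTriang C :=
    binaryBiproductTriangle_distinguished Y M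
  exact dist_of_iso H (Iso.refl _) (biprod.braiding Y M) (Iso.refl _)
    (by ext <;> simp) (by ext <;> simp) (by simp)

lemma swap_dist {L' L M Y : C} {a : L' ⟶ M} {b : L' ⟶ Y} {c : M ⟶ L} {d : Y ⟶ L}
    {w : L ⟶ L'⟦(1 : ℤ)⟧}
    (H : Triangle.mk (biprod.lift a b) (biprod.desc c d) w ∈ distTriang C) :
    Triangle.mk (biprod.lift b a) (biprod.desc d c) w ∈ distTriang C := by
  exact dist_of_iso H (Iso.refl _) (biprod.braiding M Y) (Iso.refl _)
    (by ext <;> simp) (by ext <;> simp) (by simp)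

lemma hc_one {L' L M Y X : C} {a : L' ⟶ M} {b : L' ⟶ Y} {c : M ⟶ L} {d : Y ⟶ L}
    {w : L ⟶ L'⟦(1 : ℤ)⟧}
    (H : Triangle.mk (biprod.lift a b) (biprod.desc c d) w ∈ distTriang C)
    {g : L ⟶ X} {h : X ⟶ Y⟦(1 : ℤ)⟧} (H' : Triangle.mk d g h ∈ distTriang C) :
    ∃ (g' : M ⟶ X) (h' : X ⟶ L'⟦(1 : ℤ)⟧), Triangle.mk a g' h' ∈ distTriang C := by
  have O := (IsTriangulated.octahedron_axiom (show biprod.inr ≫ biprod.desc c d = d by simp)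
    (inr_fst_dist M Y) ((rot_iff _ _ _).1 H) H').some
  refine ⟨O.m₁, O.m₃, (rot_iff _ _ _).2 ?_⟩
  have := O.mem
  rwa [Preadditive.neg_comp, ← Functor.map_comp, biprod.lift_fst] at this

lemma hc_two {L' L M Y X : C} {a : L' ⟶ M} {b : L' ⟶ Y} {c : M ⟶ L} {d : Y ⟶ L}
    {w : L ⟶ L'⟦(1 : ℤ)⟧}
    (H : Triangle.mk (biprod.lift a b) (biprod.desc c d) w ∈ distTriang C)
    {g' : M ⟶ X} {h' : X ⟶ L'⟦(1 : ℤ)⟧} (H' : Triangle.mk a g' h' ∈ distTriang C) :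
    ∃ (g : L ⟶ X) (h : X ⟶ Y⟦(1 : ℤ)⟧), Triangle.mk d g h ∈ distTriang C := by
  have O := (IsTriangulated.octahedron_axiom (show biprod.lift a b ≫ biprod.fst = a by simp)
    H ((rot_iff _ _ _).1 (inr_fst_dist M Y)) H').some
  refine ⟨O.m₁, O.m₃, (rot_iff _ _ _).2 ?_⟩
  have := O.mem
  rwa [Preadditive.neg_comp, ← Functor.map_comp, biprod.inr_desc] at this

lemma unrot {A B Z : C} {b : A ⟶ B} {g : B ⟶ Z⟦(1 : ℤ)⟧} {h : Z⟦(1 : ℤ)⟧ ⟶ A⟦(1 : ℤ)⟧}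
    (H : Triangle.mk b g h ∈ distTriang C) :
    ∃ l : Z ⟶ A, Triangle.mk l b g ∈ distTriang C := by
  refine ⟨(shiftFunctor C (1 : ℤ)).preimage (-h), (rot_iff _ _ _).2 ?_⟩
  rwa [Functor.map_preimage, neg_neg]

lemma hc_three {L' L M Y Z : C} {a : L' ⟶ M} {b : L' ⟶ Y} {c : M ⟶ L} {d : Y ⟶ L}
    {w : L ⟶ L'⟦(1 : ℤ)⟧}
    (H : Triangle.mk (biprod.lift a b) (biprod.desc c d) w ∈ distTriang C)
    {l : Z ⟶ M} {n : L ⟶ Z⟦(1 : ℤ)⟧} (H' : Triangle.mk l c n ∈ distTriang C) :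
    ∃ (l' : Z ⟶ L') (n' : Y ⟶ Z⟦(1 : ℤ)⟧), Triangle.mk l' b n' ∈ distTriang C := by
  obtain ⟨g, h, K⟩ := hc_one (swap_dist H) ((rot_iff _ _ _).1 H')
  obtain ⟨l', K'⟩ := unrot K
  exact ⟨l', g, K'⟩

lemma hc_four {L' L M Y Z : C} {a : L' ⟶ M} {b : L' ⟶ Y} {c : M ⟶ L} {d : Y ⟶ L}
    {w : L ⟶ L'⟦(1 : ℤ)⟧}
    (H : Triangle.mk (biprod.lift a b) (biprod.desc c d) w ∈ distTriang C)
    {l' : Z ⟶ L'} {n' : Y ⟶ Z⟦(1 : ℤ)⟧} (H' : Triangle.mk l' b n' ∈ distTriang C) :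
    ∃ (l : Z ⟶ M) (n : L ⟶ Z⟦(1 : ℤ)⟧), Triangle.mk l c n ∈ distTriang C := by
  obtain ⟨g, h, K⟩ := hc_two (swap_dist H) ((rot_iff _ _ _).1 H')
  obtain ⟨l', K'⟩ := unrot K
  exact ⟨l', g, K'⟩

lemma equiv_of_rel {α α' β β' : Type*} (p : α → α') (q : β → β')
    (hp : Function.Surjective p) (hq : Function.Surjective q) (P : α → β → Prop)
    (h1 : ∀ a, ∃ b, P a b) (h2 : ∀ b, ∃ a, P a b)
    (h3 : ∀ a a₁ b b₁, P a b → P a₁ b₁ → (p a = p a₁ ↔ q b = q b₁)) :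
    Nonempty (α' ≃ β') := by
  choose s hs using hp
  choose F hF using h1
  refine ⟨Equiv.ofBijective (fun x => q (F (s x))) ⟨?_, ?_⟩⟩
  · intro x y hxy
    have := (h3 _ _ _ _ (hF (s x)) (hF (s y))).2 hxy
    rwa [hs, hs] at this
  · intro y
    obtain ⟨b, rfl⟩ := hq y
    obtain ⟨a, ha⟩ := h2 b
    exact ⟨p a, (h3 _ _ _ _ (hF (s (p a))) ha).1 (hs _)⟩

variable (R : Set C) (X Y Z M : C)

/-- All pairs on the left. -/
abbrev LT := Σ L : R, WT X Y (L : C) × WT (L : C) Z M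

/-- All pairs on the right. -/
abbrev RT := Σ L : R, WT X (L : C) M × WT Y Z (L : C)

variable {R X Y Z M}

/-- Isomorphism of the underlying cospans. -/
def EL (a a₁ : LT R X Y Z M) : Prop :=
  ∃ (η : Y ≅ Y) (e : (a.1 : C) ≅ (a₁.1 : C)),
    a.2.1.1.1 ≫ e.hom = η.hom ≫ a₁.2.1.1.1 ∧ a.2.2.1.2.1 ≫ e.hom = a₁.2.2.1.2.1

/-- Isomorphism of the underlying spans. -/
def ER (b b₁ : RT R X Y Z M) : Prop :=
  ∃ (η : Y ≅ Y) (e : (b.1 : C) ≅ (b₁.1 : C)),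
    b.2.1.1.1 = e.hom ≫ b₁.2.1.1.1 ∧ b.2.2.1.2.1 ≫ η.hom = e.hom ≫ b₁.2.2.1.2.1

/-- Being in the same homotopy cartesian square. -/
def PP (a : LT R X Y Z M) (b : RT R X Y Z M) : Prop :=
  ∃ w : (a.1 : C) ⟶ (b.1 : C)⟦(1 : ℤ)⟧,
    Triangle.mk (biprod.lift b.2.1.1.1 b.2.2.1.2.1) (biprod.desc a.2.2.1.2.1 a.2.1.1.1) w
      ∈ distTriang C

lemma EL_iff_ER {a a₁ : LT R X Y Z M} {b b₁ : RT R X Y Z M} (h : PP a b) (h₁ : PP a₁ b₁) :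
    EL a a₁ ↔ ER b b₁ := by
  obtain ⟨w, H⟩ := h
  obtain ⟨w₁, H₁⟩ := h₁
  constructor
  · rintro ⟨η, e, h1, h2⟩
    obtain ⟨e', k1, -⟩ := first_iso H H₁ (biprod.mapIso (Iso.refl M) η) e
      (by ext <;> simp [h1, h2])
    refine ⟨η, e', ?_, ?_⟩
    · simpa using congrArg (fun t => t ≫ biprod.fst) k1
    · simpa using congrArg (fun t => t ≫ biprod.snd) k1
  · rintro ⟨η, e, h1, h2⟩
    obtain ⟨e', k1, -⟩ := third_iso H H₁ e (biprod.mapIso (Iso.refl M) η)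
      (by ext <;> simp [h1, h2])
    refine ⟨η, e', ?_, ?_⟩
    · simpa using congrArg (fun t => biprod.inr ≫ t) k1
    · simpa using congrArg (fun t => biprod.inl ≫ t) k1

lemma PP_left (hR : ∀ A : C, ∃! B, B ∈ R ∧ Nonempty (A ≅ B)) (a : LT R X Y Z M) :
    ∃ b, PP a b := by
  obtain ⟨⟨L, hL⟩, ⟨⟨f, g, h⟩, H1⟩, ⟨⟨l, m, n⟩, H2⟩⟩ := a
  obtain ⟨L₀, k, w, H⟩ := distinguished_cocone_triangle₁ (biprod.desc m f)
  obtain ⟨L', ⟨hL', ⟨e⟩⟩, -⟩ := hR L₀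
  have K : Triangle.mk (biprod.lift (e.inv ≫ k ≫ biprod.fst) (e.inv ≫ k ≫ biprod.snd))
      (biprod.desc m f) (w ≫ (shiftFunctor C (1 : ℤ)).map e.hom) ∈ distTriang C := by
    exact dist_of_iso H e (Iso.refl _) (Iso.refl _)
      (by ext <;> simp) (by simp) (by simp)
  obtain ⟨g', h', K1⟩ := hc_one K H1
  obtain ⟨l', n', K2⟩ := hc_three K H2
  exact ⟨⟨⟨L', hL'⟩, ⟨⟨_, _, _⟩, K1⟩, ⟨⟨_, _, _⟩, K2⟩⟩, _, K⟩

lemma PP_right (hR : ∀ A : C, ∃! B, B ∈ R ∧ Nonempty (A ≅ B)) (b : RT R X Y Z M) :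
    ∃ a, PP a b := by
  obtain ⟨⟨L', hL'⟩, ⟨⟨f, g, h⟩, H1⟩, ⟨⟨l, m, n⟩, H2⟩⟩ := b
  obtain ⟨L₀, k, w, H⟩ := distinguished_cocone_triangle (biprod.lift f m)
  obtain ⟨L, ⟨hL, ⟨e⟩⟩, -⟩ := hR L₀
  have K : Triangle.mk (biprod.lift f m)
      (biprod.desc (biprod.inl ≫ k ≫ e.hom) (biprod.inr ≫ k ≫ e.hom)) (e.inv ≫ w)
        ∈ distTriang C := by
    exact dist_of_iso H (Iso.refl _) (Iso.refl _) e
      (by simp) (by ext <;> simp) (by simp)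
  obtain ⟨g', h', K1⟩ := hc_two K H1
  obtain ⟨l', n', K2⟩ := hc_four K H2
  exact ⟨⟨⟨L, hL⟩, ⟨⟨_, _, _⟩, K1⟩, ⟨⟨_, _, _⟩, K2⟩⟩, _, K⟩

lemma rep_eq (hR : ∀ A : C, ∃! B, B ∈ R ∧ Nonempty (A ≅ B)) {L L₁ : R}
    (e : (L : C) ≅ (L₁ : C)) : L = L₁ :=
  Subtype.ext ((hR (L : C)).unique ⟨L.2, ⟨Iso.refl _⟩⟩ ⟨L₁.2, ⟨e⟩⟩)

lemma left_eq_iff (hR : ∀ A : C, ∃! B, B ∈ R ∧ Nonempty (A ≅ B)) (a a₁ : LT R X Y Z M) :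
    ((⟨a.1, Quot.mk _ a.2⟩ : Σ L : R, Quot (PairRelT X Y Z (L : C) M)) =
      ⟨a₁.1, Quot.mk _ a₁.2⟩) ↔ EL a a₁ := by
  obtain ⟨L, p⟩ := a
  obtain ⟨L₁, p₁⟩ := a₁
  constructor
  · intro h
    obtain ⟨h1, h2⟩ := Sigma.mk.inj h
    dsimp at h1
    subst h1
    have h3 : Relation.EqvGen _ p p₁ := Quot.eqvGen_exact (eq_of_heq h2)
    clear h h2
    induction h3 with
    | rel x y h =>
      obtain ⟨ξ, η, ζ, l, k1, k2, k3, k4, k5, k6⟩ := h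
      exact ⟨η, l, by dsimp; rw [k1]; exact (Iso.hom_inv_id_assoc η _).symm, by dsimp; rw [k5]⟩
    | refl x => exact ⟨Iso.refl _, Iso.refl _, by simp, by simp⟩
    | symm x y _ ih =>
      obtain ⟨η, e, k1, k2⟩ := ih
      dsimp at k1 k2
      refine ⟨η.symm, e.symm, ?_, ?_⟩
      · dsimp; rw [Iso.eq_inv_comp, ← reassoc_of% k1]; simp
      · dsimp; rw [← k2]; simp
    | trans x y z _ _ ih ih' =>
      obtain ⟨η, e, k1, k2⟩ := ih
      obtain ⟨η', e', k1', k2'⟩ := ih'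
      dsimp at k1 k2 k1' k2'
      refine ⟨η ≪≫ η', e ≪≫ e', ?_, ?_⟩
      · dsimp; rw [reassoc_of% k1, k1']; simp
      · dsimp; rw [reassoc_of% k2, k2']
  · rintro ⟨η, e, k1, k2⟩
    obtain rfl : L = L₁ := rep_eq hR e
    dsimp at k1 k2 ⊢
    congr 1
    apply Quot.sound
    obtain ⟨ξ, x1, x2⟩ := third_iso p.1.2 p₁.1.2 η e k1
    obtain ⟨ζ, z1, z2⟩ := first_iso p.2.2 p₁.2.2 (Iso.refl M) e (by simpa using k2)
    refine ⟨ξ, η, ζ, e, ?_, ?_, ?_, ?_, ?_, ?_⟩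
    · rw [k1]; simp
    · rw [x1]; simp
    · rw [x2]; simp
    · rw [Iso.eq_inv_comp, ← z1]; simp
    · exact k2.symm
    · rw [z2]; simp

lemma right_eq_iff (hR : ∀ A : C, ∃! B, B ∈ R ∧ Nonempty (A ≅ B)) (a a₁ : RT R X Y Z M) :
    ((⟨a.1, Quot.mk _ a.2⟩ : Σ L : R, Quot (PairRelT' X Y Z (L : C) M)) =
      ⟨a₁.1, Quot.mk _ a₁.2⟩) ↔ ER a a₁ := by
  obtain ⟨L, p⟩ := a
  obtain ⟨L₁, p₁⟩ := a₁
  constructor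
  · intro h
    obtain ⟨h1, h2⟩ := Sigma.mk.inj h
    dsimp at h1
    subst h1
    have h3 : Relation.EqvGen _ p p₁ := Quot.eqvGen_exact (eq_of_heq h2)
    clear h h2
    induction h3 with
    | rel x y h =>
      obtain ⟨ξ, η, ζ, l, k1, k2, k3, k4, k5, k6⟩ := h
      exact ⟨η, l, by dsimp; rw [k1]; exact (Iso.hom_inv_id_assoc l _).symm,
        by dsimp; rw [k5]; exact (Iso.hom_inv_id_assoc l _).symm⟩
    | refl x => exact ⟨Iso.refl _, Iso.refl _, by simp, by simp⟩
    | symm x y _ ih =>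
      obtain ⟨η, e, k1, k2⟩ := ih
      dsimp at k1 k2
      refine ⟨η.symm, e.symm, ?_, ?_⟩
      · dsimp; rw [k1]; simp
      · dsimp; rw [Iso.eq_inv_comp, ← reassoc_of% k2]; simp
    | trans x y z _ _ ih ih' =>
      obtain ⟨η, e, k1, k2⟩ := ih
      obtain ⟨η', e', k1', k2'⟩ := ih'
      dsimp at k1 k2 k1' k2'
      refine ⟨η ≪≫ η', e ≪≫ e', ?_, ?_⟩
      · dsimp; rw [k1, k1']; simp
      · dsimp; rw [reassoc_of% k2, k2']; simp
  · rintro ⟨η, e, k1, k2⟩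
    obtain rfl : L = L₁ := rep_eq hR e
    dsimp at k1 k2 ⊢
    congr 1
    apply Quot.sound
    obtain ⟨ξ, x1, x2⟩ := third_iso p.1.2 p₁.1.2 e (Iso.refl M) (by simpa using k1)
    obtain ⟨ζ, z1, z2⟩ := first_iso p.2.2 p₁.2.2 e η k2
    refine ⟨ξ, η, ζ, e, ?_, ?_, ?_, ?_, ?_, ?_⟩
    · rw [k1]; simp
    · rw [x1]; simp
    · rw [x2]; simp
    · rw [z1]; simp
    · rw [k2]; simp
    · rw [z2]; simp

end Aux

/-- Proposition 2: given a set `R` of representatives of the isomorphism classes of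
objects, there is a bijection between the disjoint union over `L ∈ R` of the orbit sets
`(W_{XY}^L × W_{LZ}^M)/Aut(X,Y,Z,L)` and the disjoint union over `L' ∈ R` of the orbit
sets `(W_{XL'}^M × W_{YZ}^{L'})/Aut(X,Y,Z,L')`. -/
theorem pair_orbit_bijection (R : Set C)
    (hR : ∀ A : C, ∃! B, B ∈ R ∧ Nonempty (A ≅ B)) (X Y Z M : C) :
    Nonempty ((Σ L : R, Quot (PairRelT X Y Z (L : C) M)) ≃
      (Σ L' : R, Quot (PairRelT' X Y Z (L' : C) M))) := by
  refine equiv_of_rel (α := LT R X Y Z M) (β := RT R X Y Z M)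
    (fun a => ⟨a.1, Quot.mk _ a.2⟩) (fun b => ⟨b.1, Quot.mk _ b.2⟩) ?_ ?_ PP
    (PP_left hR) (PP_right hR) ?_
  · rintro ⟨L, ⟨x⟩⟩
    exact ⟨⟨L, x⟩, rfl⟩
  · rintro ⟨L, ⟨x⟩⟩
    exact ⟨⟨L, x⟩, rfl⟩
  · intro a a₁ b b₁ h h₁
    rw [left_eq_iff hR, right_eq_iff hR]
    exact EL_iff_ER h h₁

end HallTri
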